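/- Let G be a finite insoluble group satisfying the independence property, and let S be a normal subgroup of G that is a non-abelian simple group and such that G/S is soluble. Write C for the centraliser of S in G. Suppose x, s ∈ S are elements such that the images xC and sC are dependent in the quotient group G/C. Then x and s are dependent in G; in particular, the subgroup generated by x and s is cyclic, so x and s commute. -/

import Mathlib

/-- A generating set `X` for a group is *minimal* if no proper subset of `X`
generates the group. -/
def IsMinimalGenSet {G : Type*} [Group G] (X : Set G) : Prop :=
  Subgroup.closure X = ⊤ ∧ ∀ Y : Set G, Y ⊂ X → Subgroup.closure Y ≠ ⊤

/-- Two distinct elements `x` and `y` are *independent* if some minimal generating set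
contains both of them. -/
def Independent {G : Type*} [Group G] (x y : G) : Prop :=
  x ≠ y ∧ ∃ X : Set G, IsMinimalGenSet X ∧ x ∈ X ∧ y ∈ X

/-- A group satisfies the *independence property* if any two distinct elements are either
independent or one is a power of the other. -/
def IndependenceProperty (G : Type*) [Group G] : Prop :=
  ∀ x y : G, x ≠ y →
    (Independent x y ∨ x ∈ Subgroup.zpowers y ∨ y ∈ Subgroup.zpowers x)

/-- The centraliser of a normal subgroup is normal. -/
theorem Subgroup.Normal.centralizer_normal {G : Type*} [Group G] {S : Subgroup G}
    (hS : S.Normal) : (Subgroup.centralizer (S : Set G)).Normal := by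
  constructor
  intro n hn g
  rw [Subgroup.mem_centralizer_iff] at hn ⊢
  intro s hs
  have hs' : g⁻¹ * s * g ∈ S := by simpa using hS.conj_mem s hs g⁻¹
  have h := hn _ hs'
  have := congrArg (fun t => g * t * g⁻¹) h
  simpa [mul_assoc] using this

theorem key_aux {G : Type*} [Group G]
    (S : Subgroup G) (hS : S.Normal) (hsimple : IsSimpleGroup ↥S)
    (hna : ¬ ∀ a b : ↥S, a * b = b * a)
    (hsol : Group.IsSolvable (G ⧸ S)) (H : Subgroup G)
    (hC : H ⊔ Subgroup.centralizer (S : Set G) = ⊤) (hHS : H ⊔ S = ⊤) : H = ⊤ := by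
  have hCn := hS.centralizer_normal
  have hN : ((H ⊓ S).subgroupOf S).Normal := by
    constructor
    rintro ⟨n, hnS⟩ hn ⟨g, hg⟩
    rw [Subgroup.mem_subgroupOf] at hn ⊢
    have hnH : n ∈ H := hn.1
    refine ⟨?_, S.mul_mem (S.mul_mem hg hnS) (S.inv_mem hg)⟩
    have hgt : g ∈ H ⊔ Subgroup.centralizer (S : Set G) := hC ▸ Subgroup.mem_top g
    obtain ⟨a, ha, c, hc, rfl⟩ := Subgroup.mem_sup_of_normal_right.1 hgt
    have hcn : c * n = n * c := (Subgroup.mem_centralizer_iff.1 hc n hnS).symm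
    have : a * c * n * (a * c)⁻¹ = a * n * a⁻¹ := by
      rw [mul_assoc a c n, hcn]; group
    show a * c * n * (a * c)⁻¹ ∈ H
    rw [this]
    exact H.mul_mem (H.mul_mem ha hnH) (H.inv_mem ha)
  rcases hN.eq_bot_or_eq_top with hb | ht
  · exfalso
    have hbot : ∀ g ∈ H, g ∈ S → g = 1 := by
      intro g hg hgS
      have : (⟨g, hgS⟩ : S) ∈ (H ⊓ S).subgroupOf S := ⟨hg, hgS⟩
      rw [hb, Subgroup.mem_bot] at this
      exact congrArg Subtype.val this
    have hHsol : Group.IsSolvable H := by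
      refine Group.isSolvable_of_isSolvable_injective (f := (QuotientGroup.mk' S).comp H.subtype) ?_
      rw [injective_iff_map_eq_one]
      rintro ⟨g, hg⟩ h1
      have : g ∈ S := (QuotientGroup.eq_one_iff g).1 h1
      exact Subtype.ext (hbot g hg this)
    -- S embeds in the automorphisms induced by H
    have hQ : Group.IsSolvable (G ⧸ Subgroup.centralizer (S : Set G)) := by
      refine Group.isSolvable_of_surjective
        (f := (QuotientGroup.mk' (Subgroup.centralizer (S : Set G))).comp H.subtype) ?_
      intro q
      obtain ⟨g, rfl⟩ := QuotientGroup.mk'_surjective _ q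
      have hgt : g ∈ H ⊔ Subgroup.centralizer (S : Set G) := hC ▸ Subgroup.mem_top g
      obtain ⟨a, ha, c, hc, rfl⟩ := Subgroup.mem_sup_of_normal_right.1 hgt
      refine ⟨⟨a, ha⟩, ?_⟩
      simpa using hc
    have hSsol : Group.IsSolvable S := by
      have hk : Group.IsSolvable (S ⧸ Subgroup.center S) := by
        refine Group.isSolvable_of_isSolvable_injective (f := QuotientGroup.map (Subgroup.center S)
          (Subgroup.centralizer (S : Set G)) S.subtype ?_) ?_
        · intro z hz
          rw [Subgroup.mem_comap, Subgroup.mem_centralizer_iff]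
          intro t ht
          exact congrArg Subtype.val (Subgroup.mem_center_iff.1 hz ⟨t, ht⟩)
        · rw [injective_iff_map_eq_one]
          intro q hq
          obtain ⟨t, rfl⟩ := QuotientGroup.mk'_surjective _ q
          have h1 : (t : G) ∈ Subgroup.centralizer (S : Set G) :=
            (QuotientGroup.eq_one_iff _).1 hq
          refine (QuotientGroup.eq_one_iff t).2 (Subgroup.mem_center_iff.2 fun u => ?_)
          exact Subtype.ext (Subgroup.mem_centralizer_iff.1 h1 u u.2)
      have hz : Group.IsSolvable (Subgroup.center S) := Group.isSolvable_of_comm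
        fun a b => Subtype.ext (Subgroup.mem_center_iff.1 b.2 a)
      refine Group.isSolvable_of_ker_le_range (Subgroup.center S).subtype
        (QuotientGroup.mk' (Subgroup.center S)) ?_
      simp
    exact hna (IsSimpleGroup.comm_iff_isSolvable.2 hSsol)
  · have hle : S ≤ H := by
      intro g hg
      have : (⟨g, hg⟩ : S) ∈ (H ⊓ S).subgroupOf S := ht ▸ Subgroup.mem_top _
      exact this.1
    rwa [sup_eq_left.2 hle] at hHS

theorem inj_aux {G : Type*} [Group G]
    (S : Subgroup G) (hsimple : IsSimpleGroup ↥S)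
    (hna : ¬ ∀ a b : ↥S, a * b = b * a) (g : G) (hg : g ∈ S)
    (hc : g ∈ Subgroup.centralizer (S : Set G)) : g = 1 := by
  have hz : (⟨g, hg⟩ : S) ∈ Subgroup.center S :=
    Subgroup.mem_center_iff.2 fun u => Subtype.ext (Subgroup.mem_centralizer_iff.1 hc u u.2)
  rcases (inferInstance : (Subgroup.center S).Normal).eq_bot_or_eq_top with hb | ht
  · rw [hb, Subgroup.mem_bot] at hz
    exact congrArg Subtype.val hz
  · refine absurd (fun a b => ?_) hna
    exact (Subgroup.mem_center_iff.1 (ht ▸ Subgroup.mem_top b : b ∈ Subgroup.center S) a)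

theorem drop_aux {G : Type*} [Group G]
    (S : Subgroup G) (hS : S.Normal) (hsimple : IsSimpleGroup ↥S)
    (hna : ¬ ∀ a b : ↥S, a * b = b * a)
    (hsol : Group.IsSolvable (G ⧸ S)) (C : Subgroup G) (hCn : C.Normal)
    (hCe : C = Subgroup.centralizer (S : Set G))
    (X : Set G) (hX : IsMinimalGenSet X) (x : G) (hxX : x ∈ X) (hx : x ∈ S)
    (Z : Set (G ⧸ C)) (hZX : Z ⊆ (QuotientGroup.mk' C) '' X) (hZ : Subgroup.closure Z = ⊤) :
    QuotientGroup.mk' C x ∈ Z := by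
  by_contra hcon
  refine hX.2 (X \ {x}) (Set.sdiff_singleton_ssubset.2 hxX) ?_
  refine key_aux S hS hsimple hna hsol _ ?_ ?_
  · rw [← hCe]
    have hm : (Subgroup.closure (X \ {x})).map (QuotientGroup.mk' C) = ⊤ := by
      rw [MonoidHom.map_closure, eq_top_iff, ← hZ]
      apply Subgroup.closure_mono
      intro z hz
      obtain ⟨y, hy, rfl⟩ := hZX hz
      refine ⟨y, ⟨hy, ?_⟩, rfl⟩
      rintro rfl
      exact hcon hz
    have := congrArg (Subgroup.comap (QuotientGroup.mk' C)) hm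
    rw [Subgroup.comap_map_eq] at this
    simpa using this
  · rw [eq_top_iff, ← hX.1, Subgroup.closure_le]
    intro y hy
    by_cases hyx : y = x
    · subst hyx
      exact Subgroup.mem_sup_right hx
    · exact Subgroup.mem_sup_left (Subgroup.subset_closure ⟨hy, hyx⟩)


/-- Let `G` be a finite insoluble group satisfying the independence
property, `S` a normal subgroup of `G` which is a non-abelian simple group with `G / S`
soluble, and `C` the centraliser of `S` in `G`.  If `x, s ∈ S` have dependent images in
`G / C`, then `x` and `s` are dependent in `G`; in particular `⟨x, s⟩` is cyclic and
`x` and `s` commute. -/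
theorem stmt_11 (G : Type*) [Group G] [Finite G] (hns : ¬ IsSolvable G)
    (h : IndependenceProperty G)
    (S : Subgroup G) (hS : S.Normal) (hsimple : IsSimpleGroup ↥S)
    (hna : ¬ ∀ a b : ↥S, a * b = b * a)
    (hsol : @IsSolvable (G ⧸ S) (@QuotientGroup.Quotient.group G _ S hS))
    (x s : G) (hx : x ∈ S) (hs : s ∈ S)
    (hdep : ¬ @Independent (G ⧸ Subgroup.centralizer (S : Set G))
      (@QuotientGroup.Quotient.group G _ (Subgroup.centralizer (S : Set G))
        hS.centralizer_normal)
      (QuotientGroup.mk x) (QuotientGroup.mk s)) :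
    ¬ Independent x s ∧ IsCyclic ↥(Subgroup.closure ({x, s} : Set G)) ∧ x * s = s * x := by
  have hind : ¬ Independent x s := by
    rintro ⟨hne, X, hX, hxX, hsX⟩
    have hCn := hS.centralizer_normal
    apply hdep
    refine ⟨?_, ?_⟩
    · intro heq
      have h1 : x⁻¹ * s ∈ Subgroup.centralizer (S : Set G) := QuotientGroup.eq.1 heq
      have h2 := inj_aux S hsimple hna _ (S.mul_mem (S.inv_mem hx) hs) h1
      exact hne (inv_mul_eq_one.1 h2)
    · have hwf : WellFounded
          (fun a b : Set (G ⧸ Subgroup.centralizer (S : Set G)) => a < b) := wellFounded_lt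
      obtain ⟨Z, ⟨hZX, hZ⟩, hmin⟩ := hwf.has_min
        {Z | Z ⊆ (QuotientGroup.mk' (Subgroup.centralizer (S : Set G))) '' X ∧
          Subgroup.closure Z = ⊤}
        ⟨_, Set.Subset.rfl, by
          rw [← MonoidHom.map_closure, hX.1]
          exact Subgroup.map_top_of_surjective _ (QuotientGroup.mk'_surjective _)⟩
      refine ⟨Z, ⟨hZ, fun Y hY hYt => hmin Y ⟨hY.1.trans hZX, hYt⟩ hY⟩, ?_, ?_⟩
      · exact drop_aux S hS hsimple hna hsol _ hCn rfl X hX x hxX hx Z hZX hZ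
      · exact drop_aux S hS hsimple hna hsol _ hCn rfl X hX s hsX hs Z hZX hZ
  have hcyc : ∃ g, x ∈ Subgroup.zpowers g ∧ s ∈ Subgroup.zpowers g := by
    by_cases hxs : x = s
    · exact ⟨x, Subgroup.mem_zpowers x, hxs ▸ Subgroup.mem_zpowers x⟩
    · rcases h x s hxs with h1 | h1 | h1
      · exact absurd h1 hind
      · exact ⟨s, h1, Subgroup.mem_zpowers s⟩
      · exact ⟨x, Subgroup.mem_zpowers x, h1⟩
  obtain ⟨g, hxg, hsg⟩ := hcyc
  refine ⟨hind, ?_, ?_⟩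
  · have hle : Subgroup.closure ({x, s} : Set G) ≤ Subgroup.zpowers g := by
      rw [Subgroup.closure_le]
      rintro y (rfl | rfl)
      · exact hxg
      · exact hsg
    exact isCyclic_of_injective (Subgroup.inclusion hle) (Subgroup.inclusion_injective hle)
  · obtain ⟨a, rfl⟩ := hxg
    obtain ⟨b, rfl⟩ := hsg
    exact zpow_mul_comm g a b
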